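/- For every node u ∈ V, the PageRank score satisfies π(u) ≥ max( α/n , α·d_u·√(2(1−α)) / (n·√m) ). -/

import Mathlib

open Matrix

section PageRank

variable {V : Type*} [Fintype V] (G : SimpleGraph V) [DecidableRel G.Adj]

/-- The entrywise form of the PageRank equation. -/
lemma pageRank_apply [DecidableEq V] (hdeg : ∀ v : V, 0 < G.degree v) (a b : ℝ) (pr : V → ℝ)
    (hpr : pr = a • (G.adjMatrix ℝ *
        (Matrix.diagonal fun v => (G.degree v : ℝ))⁻¹).mulVec pr + b • (1 : V → ℝ)) (u : V) :
    pr u = a * ∑ v ∈ G.neighborFinset u, pr v / (G.degree v : ℝ) + b := by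
  have hinv : (Matrix.diagonal fun v => (G.degree v : ℝ))⁻¹ =
      Matrix.diagonal fun v => (G.degree v : ℝ)⁻¹ := by
    refine Matrix.inv_eq_right_inv ?_
    rw [Matrix.diagonal_mul_diagonal, ← Matrix.diagonal_one]
    congr 1
    ext v
    exact mul_inv_cancel₀ (by exact_mod_cast (hdeg v).ne')
  have h := congrFun hpr u
  rw [hinv, ← Matrix.mulVec_mulVec] at h
  simpa [-Matrix.mulVec_mulVec, SimpleGraph.adjMatrix_mulVec_apply, Matrix.mulVec_diagonal,
    div_eq_inv_mul] using h

/-- A solution of the PageRank equation with nonnegative source term is nonnegative. -/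
lemma pageRank_nonneg (hdeg : ∀ v : V, 0 < G.degree v) {a b : ℝ} (ha0 : 0 ≤ a) (ha1 : a < 1)
    (hb : 0 ≤ b) {pr : V → ℝ}
    (h : ∀ u, pr u = a * ∑ v ∈ G.neighborFinset u, pr v / (G.degree v : ℝ) + b) (u : V) :
    0 ≤ pr u := by
  have hd (v : V) : (0 : ℝ) < G.degree v := by exact_mod_cast hdeg v
  have : Nonempty V := ⟨u⟩
  obtain ⟨w, hw⟩ := Finite.exists_min fun v => pr v / (G.degree v : ℝ)
  have hsum : (G.degree w : ℝ) * (pr w / G.degree w) ≤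
      ∑ v ∈ G.neighborFinset w, pr v / (G.degree v : ℝ) := by
    rw [← nsmul_eq_mul, ← G.card_neighborFinset_eq_degree w]
    exact Finset.card_nsmul_le_sum _ _ _ fun v _ => hw v
  rw [mul_div_cancel₀ _ (hd w).ne'] at hsum
  have hpw : 0 ≤ pr w := by nlinarith [h w, mul_le_mul_of_nonneg_left hsum ha0]
  have hmin : 0 ≤ pr u / (G.degree u : ℝ) := (div_nonneg hpw (hd w).le).trans (hw u)
  simpa [mul_div_cancel₀ _ (hd u).ne'] using mul_nonneg (hd u).le hmin

/-- The reciprocal degrees of the neighbors of `u` sum to at least `d_u² / (2m)`. -/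
lemma sq_degree_div_le_sum_inv_degree (hdeg : ∀ v : V, 0 < G.degree v) (u : V) :
    (G.degree u : ℝ) ^ 2 / (2 * (G.edgeFinset.card : ℝ)) ≤
      ∑ v ∈ G.neighborFinset u, 1 / (G.degree v : ℝ) := by
  have hd (v : V) : (0 : ℝ) < G.degree v := by exact_mod_cast hdeg v
  have hne : (G.neighborFinset u).Nonempty := by
    rw [← Finset.card_pos, G.card_neighborFinset_eq_degree]
    exact hdeg u
  have hpos : 0 < ∑ v ∈ G.neighborFinset u, (G.degree v : ℝ) :=
    Finset.sum_pos (fun v _ => hd v) hne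
  have hle : ∑ v ∈ G.neighborFinset u, (G.degree v : ℝ) ≤ 2 * (G.edgeFinset.card : ℝ) := by
    calc ∑ v ∈ G.neighborFinset u, (G.degree v : ℝ) ≤ ∑ v, (G.degree v : ℝ) :=
          Finset.sum_le_sum_of_subset_of_nonneg (Finset.subset_univ _) fun v _ _ => (hd v).le
      _ = 2 * (G.edgeFinset.card : ℝ) := by exact_mod_cast G.sum_degrees_eq_twice_card_edges
  have hcs := Finset.sq_sum_div_le_sum_sq_div (G.neighborFinset u) (fun _ => (1 : ℝ))
    (g := fun v => (G.degree v : ℝ)) fun v _ => hd v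
  simp only [Finset.sum_const, nsmul_eq_mul, mul_one, one_pow,
    G.card_neighborFinset_eq_degree] at hcs
  exact (div_le_div_of_nonneg_left (sq_nonneg _) hpos hle).trans hcs

end PageRank

/-- For every node `u ∈ V`, the PageRank score satisfies
`π(u) ≥ max( α/n , α·d_u·√(2(1−α)) / (n·√m) )`. -/
theorem stmt_7 {V : Type*} [Fintype V] [DecidableEq V]
    (G : SimpleGraph V) [DecidableRel G.Adj]
    (hdeg : ∀ v : V, 0 < G.degree v)
    (α : ℝ) (hα0 : 0 < α) (hα1 : α < 1)
    (pr : V → ℝ)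
    (hpr : pr = (1 - α) •
        (G.adjMatrix ℝ * (Matrix.diagonal fun v => (G.degree v : ℝ))⁻¹).mulVec pr
      + (α / (Fintype.card V : ℝ)) • (1 : V → ℝ)) :
    ∀ u : V,
      max (α / (Fintype.card V : ℝ))
          (α * (G.degree u : ℝ) * Real.sqrt (2 * (1 - α)) /
            ((Fintype.card V : ℝ) * Real.sqrt (G.edgeFinset.card : ℝ))) ≤ pr u := by
  intro u
  have hd (v : V) : (0 : ℝ) < G.degree v := by exact_mod_cast hdeg v
  have hb : 0 ≤ α / (Fintype.card V : ℝ) := by positivity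
  have ha0 : 0 ≤ 1 - α := by linarith
  have h := pageRank_apply G hdeg _ _ pr hpr
  have hnonneg := pageRank_nonneg G hdeg ha0 (by linarith) hb h
  have hlow (v : V) : α / (Fintype.card V : ℝ) ≤ pr v := by
    rw [h v]
    exact le_add_of_nonneg_left <| mul_nonneg ha0 <|
      Finset.sum_nonneg fun w _ => div_nonneg (hnonneg w) (hd w).le
  refine max_le (hlow u) ?_
  have hm : (0 : ℝ) < G.edgeFinset.card := by
    have htwice : ∑ v, (G.degree v : ℝ) = 2 * (G.edgeFinset.card : ℝ) := by
      exact_mod_cast G.sum_degrees_eq_twice_card_edges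
    linarith [hd u, Finset.single_le_sum (f := fun v => (G.degree v : ℝ))
      (fun v _ => (hd v).le) (Finset.mem_univ u)]
  have hsum : α / (Fintype.card V : ℝ) *
      ((G.degree u : ℝ) ^ 2 / (2 * (G.edgeFinset.card : ℝ))) ≤
        ∑ v ∈ G.neighborFinset u, pr v / (G.degree v : ℝ) := by
    refine (mul_le_mul_of_nonneg_left (sq_degree_div_le_sum_inv_degree G hdeg u) hb).trans ?_
    rw [Finset.mul_sum]
    refine Finset.sum_le_sum fun v _ => ?_
    rw [mul_one_div]
    exact div_le_div_of_nonneg_right (hlow v) (hd v).le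
  set t := (G.degree u : ℝ) * (√(2 * (1 - α)) / √(G.edgeFinset.card : ℝ)) with ht
  have htsq : t ^ 2 = 4 * ((1 - α) * ((G.degree u : ℝ) ^ 2 / (2 * (G.edgeFinset.card : ℝ)))) := by
    rw [ht, mul_pow, div_pow, Real.sq_sqrt (by positivity), Real.sq_sqrt hm.le]
    clear hpr h
    field_simp
    ring
  calc α * (G.degree u : ℝ) * √(2 * (1 - α)) /
        ((Fintype.card V : ℝ) * √(G.edgeFinset.card : ℝ))
      = α / (Fintype.card V : ℝ) * t := by rw [ht, mul_assoc, mul_div_mul_comm, mul_div_assoc]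
    _ ≤ α / (Fintype.card V : ℝ) * (t ^ 2 / 4 + 1) :=
        mul_le_mul_of_nonneg_left (by nlinarith [sq_nonneg (t - 2)]) hb
    _ = (1 - α) * (α / (Fintype.card V : ℝ) *
          ((G.degree u : ℝ) ^ 2 / (2 * (G.edgeFinset.card : ℝ)))) +
            α / (Fintype.card V : ℝ) := by rw [htsq]; ring
    _ ≤ pr u := by
        rw [h u]
        exact add_le_add_left (mul_le_mul_of_nonneg_left hsum ha0) _
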